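/- Polynomial L∞–H^{1/2} inverse inequality with logarithmic factor: there exists a constant C > 0 such that for every integer W ≥ 2 and every real polynomial q of degree at most W on I = (−1,1), one has ‖q‖²_{L∞([−1,1])} ≤ C (ln W) ‖q‖²_{1/2,I}. -/

import Mathlib

open MeasureTheory

noncomputable section

/-- The open reference interval `I = (−1,1)`. -/
def Iv : Set ℝ := Set.Ioo (-1 : ℝ) 1

/-- Squared fractional Sobolev norm of order `1/2` on `I = (−1,1)`:
`‖w‖²_{1/2,I} = ∫_I w² + ∫_I∫_I |w(ξ)−w(ξ′)|²/|ξ−ξ′|² dξ dξ′`. -/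
def halfNormSq (w : ℝ → ℝ) : ℝ :=
  (∫ t in Iv, (w t) ^ 2) + ∫ t in Iv, ∫ s in Iv, (w t - w s) ^ 2 / |t - s| ^ 2

open Polynomial in
/-- Markov's inequality at the endpoint `1`. -/
lemma abs_eval_one_derivative_le {n : ℕ} {P : ℝ[X]} {M : ℝ} (hM : 0 < M)
    (hdeg : P.natDegree ≤ n) (hP : ∀ x ∈ Set.Icc (-1 : ℝ) 1, |P.eval x| ≤ M) :
    |(derivative P).eval 1| ≤ n ^ 2 * M := by
  have hT : (derivative (Chebyshev.T ℝ n)).eval 1 = (n : ℝ) ^ 2 := by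
    rw [Chebyshev.T_derivative_eq_U]
    simp [sq]
  have key : ∀ c : ℝ, |c| = M⁻¹ → c * (derivative P).eval 1 ≤ n ^ 2 := by
    intro c hc
    have h := Chebyshev.eval_iterate_derivative_le_of_forall_abs_le_one
      (n := n) (P := C c * P) (k := 1) (x := 1) le_rfl
      (natDegree_le_iff_degree_le.mp ((natDegree_C_mul_le c P).trans hdeg)) (by
        intro x hx
        rw [eval_mul, eval_C, abs_mul, hc, inv_mul_le_one₀ hM]
        exact hP x hx)
    simpa [hT] using h
  have h₁ := key M⁻¹ (abs_of_pos (inv_pos.mpr hM))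
  have h₂ := key (-M⁻¹) (by rw [abs_neg, abs_of_pos (inv_pos.mpr hM)])
  rw [inv_mul_le_iff₀ hM] at h₁
  rw [neg_mul, ← mul_neg, inv_mul_le_iff₀ hM] at h₂
  rw [mul_comm]
  exact abs_le'.mpr ⟨h₁, h₂⟩

open Polynomial in
/-- Markov's inequality on `[-1, 1]`, up to a factor `2`. -/
lemma abs_eval_derivative_le {n : ℕ} {P : ℝ[X]} {M : ℝ} (hM : 0 < M)
    (hdeg : P.natDegree ≤ n) (hP : ∀ x ∈ Set.Icc (-1 : ℝ) 1, |P.eval x| ≤ M)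
    {x : ℝ} (hx : x ∈ Set.Icc (-1 : ℝ) 1) :
    |(derivative P).eval x| ≤ 2 * n ^ 2 * M := by
  have key : ∀ a b : ℝ, a + b = x → |a| + |b| ≤ 1 → 1 / 2 ≤ |b| →
      |(derivative P).eval x| ≤ 2 * n ^ 2 * M := by
    intro a b hab h₁ h₂
    have hlin : (C a + C b * X).natDegree ≤ 1 := by
      rw [add_comm]; exact natDegree_linear_le
    have h := abs_eval_one_derivative_le (n := n) (P := P.comp (C a + C b * X)) hM
      (natDegree_comp_le.trans ((Nat.mul_le_mul hdeg hlin).trans_eq (mul_one n))) (by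
        intro y hy
        simp only [eval_comp, eval_add, eval_C, eval_mul, eval_X]
        refine hP _ (abs_le.mp ?_)
        calc |a + b * y| ≤ |a| + |b| * |y| := by
              rw [← abs_mul]; exact abs_add_le _ _
          _ ≤ |a| + |b| * 1 := by gcongr; exact abs_le.mpr hy
          _ ≤ 1 := by linarith)
    simp only [derivative_comp, derivative_add, derivative_C, derivative_C_mul, derivative_X,
      eval_mul, eval_comp, eval_add, eval_C, eval_X, mul_one, zero_add, abs_mul, hab] at h
    nlinarith [abs_nonneg ((derivative P).eval x)]
  rcases le_total 0 x with h0 | h0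
  · refine key ((x - 1) / 2) ((x + 1) / 2) (by ring) ?_ ?_
    · rw [abs_of_nonpos (by linarith [hx.2]), abs_of_nonneg (by linarith)]; linarith
    · rw [abs_of_nonneg (by linarith)]; linarith
  · refine key ((x + 1) / 2) ((x - 1) / 2) (by ring) ?_ ?_
    · rw [abs_of_nonneg (by linarith [hx.1]), abs_of_nonpos (by linarith)]; linarith
    · rw [abs_of_nonpos (by linarith)]; linarith

/-- The squared distance from the mean to a constant is at most the mean squared distance. -/
lemma sub_mul_sq_mean_sub_le {f : ℝ → ℝ} (hf : Continuous f) {a b : ℝ} (hab : a < b) (c : ℝ) :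
    (b - a) * ((b - a)⁻¹ * (∫ t in a..b, f t) - c) ^ 2 ≤ ∫ t in a..b, (f t - c) ^ 2 := by
  set m := (b - a)⁻¹ * ∫ t in a..b, f t with hm
  have hba : 0 < b - a := sub_pos.mpr hab
  have hint : ∫ t in a..b, f t = (b - a) * m := by rw [hm, mul_inv_cancel_left₀ hba.ne']
  have hlin : ∫ t in a..b, (2 * (m - c) * f t + (c ^ 2 - m ^ 2)) = (b - a) * (m - c) ^ 2 := by
    rw [intervalIntegral.integral_add ((by fun_prop : Continuous _).intervalIntegrable _ _)
      (by simp), intervalIntegral.integral_const_mul, hint, intervalIntegral.integral_const,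
      smul_eq_mul]
    ring
  rw [← hlin]
  refine intervalIntegral.integral_mono_on hab.le
    ((by fun_prop : Continuous _).intervalIntegrable _ _)
    ((by fun_prop : Continuous _).intervalIntegrable _ _) fun t _ => ?_
  nlinarith [sq_nonneg (f t - m)]

lemma abs_mean_sub_le {f : ℝ → ℝ} (hf : Continuous f) {a b : ℝ} (hab : a < b) {c δ : ℝ}
    (h : ∀ t ∈ Set.Icc a b, |f t - c| ≤ δ) :
    |(b - a)⁻¹ * (∫ t in a..b, f t) - c| ≤ δ := by
  have hba : 0 < b - a := sub_pos.mpr hab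
  have hδ : 0 ≤ δ := (abs_nonneg _).trans (h a (Set.left_mem_Icc.mpr hab.le))
  have h₁ := sub_mul_sq_mean_sub_le hf hab c
  have h₂ : ∫ t in a..b, (f t - c) ^ 2 ≤ ∫ _t in a..b, δ ^ 2 :=
    intervalIntegral.integral_mono_on hab.le
      ((by fun_prop : Continuous _).intervalIntegrable _ _) (by simp)
      fun t ht => sq_le_sq' (abs_le.mp (h t ht)).1 (abs_le.mp (h t ht)).2
  rw [intervalIntegral.integral_const, smul_eq_mul] at h₂
  exact abs_le_of_sq_le_sq (le_of_mul_le_mul_left (h₁.trans h₂) hba) hδ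

/-- The inner integral of the Gagliardo seminorm. -/
def gagliardoInner (f : ℝ → ℝ) (t : ℝ) : ℝ :=
  ∫ s in Iv, (f t - f s) ^ 2 / |t - s| ^ 2

lemma volume_Iv : volume Iv = 2 := by
  rw [Iv, Real.volume_Ioo]; norm_num

lemma measurableSet_Iv : MeasurableSet Iv := measurableSet_Ioo

lemma gagliardoInner_nonneg (f : ℝ → ℝ) (t : ℝ) : 0 ≤ gagliardoInner f t :=
  integral_nonneg fun _ => by positivity

lemma halfNormSq_eq (f : ℝ → ℝ) :
    halfNormSq f = (∫ t in Iv, f t ^ 2) + ∫ t in Iv, gagliardoInner f t := rfl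

lemma gagliardo_kernel_le {f : ℝ → ℝ} {L t s : ℝ} (h : |f t - f s| ≤ L * |t - s|) :
    (f t - f s) ^ 2 / |t - s| ^ 2 ≤ L ^ 2 := by
  refine div_le_of_le_mul₀ (by positivity) (by positivity) ?_
  rw [← mul_pow, ← sq_abs]
  gcongr

lemma integrableOn_gagliardo_kernel {f : ℝ → ℝ} (hf : Continuous f) {L : ℝ}
    (hL : ∀ t ∈ Iv, ∀ s ∈ Iv, |f t - f s| ≤ L * |t - s|) {t : ℝ} (ht : t ∈ Iv) :
    IntegrableOn (fun s => (f t - f s) ^ 2 / |t - s| ^ 2) Iv := by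
  refine Measure.integrableOn_of_bounded (M := L ^ 2) (by simp [volume_Iv])
    (Measurable.aestronglyMeasurable ?_) ?_
  · have := hf.measurable
    fun_prop
  · filter_upwards [ae_restrict_mem measurableSet_Iv] with s hs
    rw [Real.norm_of_nonneg (by positivity)]
    exact gagliardo_kernel_le (hL t ht s hs)

lemma integrableOn_gagliardoInner {f : ℝ → ℝ} (hf : Continuous f) {L : ℝ}
    (hL : ∀ t ∈ Iv, ∀ s ∈ Iv, |f t - f s| ≤ L * |t - s|) :
    IntegrableOn (gagliardoInner f) Iv := by
  refine Measure.integrableOn_of_bounded (M := L ^ 2 * 2) (by simp [volume_Iv]) ?_ ?_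
  · have hm := hf.measurable
    have : Measurable fun p : ℝ × ℝ => (f p.1 - f p.2) ^ 2 / |p.1 - p.2| ^ 2 := by fun_prop
    exact (this.stronglyMeasurable.integral_prod_right' (ν := volume.restrict Iv)
      ).aestronglyMeasurable
  · filter_upwards [ae_restrict_mem measurableSet_Iv] with t ht
    have h := norm_setIntegral_le_of_norm_le_const (μ := volume) (s := Iv) (C := L ^ 2)
      (f := fun s => (f t - f s) ^ 2 / |t - s| ^ 2) (by simp [volume_Iv]) fun s hs => by
        rw [Real.norm_of_nonneg (by positivity)]
        exact gagliardo_kernel_le (hL t ht s hs)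
    simpa [measureReal_def, volume_Iv, gagliardoInner] using h

/-- The mean of `f` over the dyadic interval `[x + 2⁻ᵏ⁻¹, x + 2⁻ᵏ]`. -/
def dyadicMean (f : ℝ → ℝ) (x : ℝ) (k : ℕ) : ℝ :=
  (x + (1 / 2) ^ k - (x + (1 / 2) ^ (k + 1)))⁻¹ *
    ∫ t in (x + (1 / 2) ^ (k + 1))..(x + (1 / 2) ^ k), f t

lemma half_pow_succ_lt (x : ℝ) (k : ℕ) : x + (1 / 2) ^ (k + 1) < x + (1 / 2 : ℝ) ^ k := by
  have : (0 : ℝ) < (1 / 2) ^ k := by positivity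
  rw [pow_succ]; linarith

lemma Ioo_dyadic_subset {x : ℝ} (hx : x ∈ Set.Icc (-1 : ℝ) 0) (k : ℕ) :
    Set.Ioo (x + (1 / 2) ^ (k + 1)) (x + (1 / 2) ^ k) ⊆ Iv := by
  intro t ht
  have h₁ : (0 : ℝ) < (1 / 2) ^ (k + 1) := by positivity
  have h₂ : (1 / 2 : ℝ) ^ k ≤ 1 := pow_le_one₀ (by norm_num) (by norm_num)
  exact ⟨by linarith [ht.1, hx.1], by linarith [ht.2, hx.2]⟩

lemma sq_dyadicMean_sub_le {f : ℝ → ℝ} (hf : Continuous f) {L : ℝ}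
    (hL : ∀ t ∈ Iv, ∀ s ∈ Iv, |f t - f s| ≤ L * |t - s|) {x : ℝ}
    (hx : x ∈ Set.Icc (-1 : ℝ) 0) (k : ℕ) :
    (dyadicMean f x k - dyadicMean f x (k + 1)) ^ 2 ≤
      8 * ∫ t in Set.Ioo (x + (1 / 2) ^ (k + 1)) (x + (1 / 2) ^ k), gagliardoInner f t := by
  set r : ℝ := (1 / 2) ^ k with hr
  have hr0 : 0 < r := by positivity
  have hr1 : (1 / 2 : ℝ) ^ (k + 1) = r / 2 := by rw [pow_succ, hr]; ring
  have hr2 : (1 / 2 : ℝ) ^ (k + 1 + 1) = r / 4 := by rw [pow_succ, hr1]; ring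
  have hs₁ := Ioo_dyadic_subset hx k
  have hs₂ := Ioo_dyadic_subset hx (k + 1)
  have hpoint : ∀ t ∈ Set.Ioo (x + (1 / 2) ^ (k + 1)) (x + r),
      (f t - dyadicMean f x (k + 1)) ^ 2 ≤ 4 * r * gagliardoInner f t := by
    intro t ht
    have h₁ := sub_mul_sq_mean_sub_le hf (half_pow_succ_lt x (k + 1)) (f t)
    have h₂ : ∫ s in (x + (1 / 2) ^ (k + 1 + 1))..(x + (1 / 2) ^ (k + 1)), (f s - f t) ^ 2
        ≤ r ^ 2 * gagliardoInner f t := by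
      rw [intervalIntegral.integral_of_le (half_pow_succ_lt x (k + 1)).le,
        integral_Ioc_eq_integral_Ioo, gagliardoInner, ← integral_const_mul]
      have hK : IntegrableOn (fun s => r ^ 2 * ((f t - f s) ^ 2 / |t - s| ^ 2)) Iv :=
        (integrableOn_gagliardo_kernel hf hL (hs₁ ht)).const_mul (r ^ 2)
      refine le_trans ?_ (setIntegral_mono_set hK
        (Filter.Eventually.of_forall fun s => by positivity)
        (Filter.Eventually.of_forall hs₂))
      refine setIntegral_mono_on ?_ (hK.mono_set hs₂) measurableSet_Ioo fun s hs => ?_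
      · exact ((by fun_prop : Continuous _).integrableOn_Icc).mono_set Set.Ioo_subset_Icc_self
      · rw [hr1] at ht
        rw [hr1, hr2] at hs
        have hts : 0 < t - s := by linarith [ht.1, hs.2]
        rw [abs_of_pos hts, mul_div_assoc', le_div_iff₀ (by positivity)]
        have : (t - s) ^ 2 ≤ r ^ 2 := by
          have : t - s ≤ r := by linarith [ht.2, hs.1]
          gcongr
        nlinarith [sq_nonneg (f t - f s)]
    have h₃ := h₁.trans h₂
    change (x + (1 / 2) ^ (k + 1) - (x + (1 / 2) ^ (k + 1 + 1))) *
      (dyadicMean f x (k + 1) - f t) ^ 2 ≤ _ at h₃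
    rw [hr1, hr2] at h₃
    have h₄ : r * (f t - dyadicMean f x (k + 1)) ^ 2 ≤ r * (4 * r * gagliardoInner f t) := by
      linarith
    exact le_of_mul_le_mul_left h₄ hr0
  have h₁ := sub_mul_sq_mean_sub_le hf (half_pow_succ_lt x k) (dyadicMean f x (k + 1))
  have h₂ : ∫ t in (x + (1 / 2) ^ (k + 1))..(x + (1 / 2) ^ k),
      (f t - dyadicMean f x (k + 1)) ^ 2 ≤
      4 * r * ∫ t in Set.Ioo (x + (1 / 2) ^ (k + 1)) (x + r), gagliardoInner f t := by
    rw [intervalIntegral.integral_of_le (half_pow_succ_lt x k).le,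
      integral_Ioc_eq_integral_Ioo, ← integral_const_mul]
    refine setIntegral_mono_on ?_ (((integrableOn_gagliardoInner hf hL).mono_set hs₁).const_mul _)
      measurableSet_Ioo hpoint
    exact ((by fun_prop : Continuous _).integrableOn_Icc).mono_set Set.Ioo_subset_Icc_self
  have h₃ := h₁.trans h₂
  change (x + r - (x + (1 / 2) ^ (k + 1))) *
    (dyadicMean f x k - dyadicMean f x (k + 1)) ^ 2 ≤ _ at h₃
  refine le_of_mul_le_mul_left ?_ hr0
  rw [hr1] at h₃ ⊢
  linarith

lemma sum_sq_dyadicMean_sub_le {f : ℝ → ℝ} (hf : Continuous f) {L : ℝ}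
    (hL : ∀ t ∈ Iv, ∀ s ∈ Iv, |f t - f s| ≤ L * |t - s|) {x : ℝ}
    (hx : x ∈ Set.Icc (-1 : ℝ) 0) (N : ℕ) :
    ∑ k ∈ Finset.range N, (dyadicMean f x k - dyadicMean f x (k + 1)) ^ 2 ≤
      8 * ∫ t in Iv, gagliardoInner f t := by
  have hG := integrableOn_gagliardoInner hf hL
  have hanti : Antitone fun k : ℕ => x + (1 / 2 : ℝ) ^ k :=
    antitone_nat_of_succ_le fun k => (half_pow_succ_lt x k).le
  have hdisj : Pairwise (Function.onFun Disjoint fun k : ℕ =>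
      Set.Ioo (x + (1 / 2 : ℝ) ^ (k + 1)) (x + (1 / 2) ^ k)) :=
    hanti.pairwise_disjoint_on_Ioo_succ
  calc _ ≤ ∑ k ∈ Finset.range N, 8 * ∫ t in Set.Ioo (x + (1 / 2) ^ (k + 1)) (x + (1 / 2) ^ k),
        gagliardoInner f t := Finset.sum_le_sum fun k _ => sq_dyadicMean_sub_le hf hL hx k
    _ = 8 * ∫ t in ⋃ k ∈ Finset.range N, Set.Ioo (x + (1 / 2) ^ (k + 1)) (x + (1 / 2) ^ k),
        gagliardoInner f t := by
      rw [← Finset.mul_sum, integral_biUnion_finset _ (fun _ _ => measurableSet_Ioo)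
        (fun i _ j _ hij => hdisj hij) fun k _ => hG.mono_set (Ioo_dyadic_subset hx k)]
    _ ≤ 8 * ∫ t in Iv, gagliardoInner f t := by
      refine mul_le_mul_of_nonneg_left (setIntegral_mono_set hG
        (Filter.Eventually.of_forall (gagliardoInner_nonneg f))
        (Filter.Eventually.of_forall ?_)) (by norm_num)
      exact Set.iUnion₂_subset fun k _ => Ioo_dyadic_subset hx k

lemma sq_dyadicMean_zero_le {f : ℝ → ℝ} (hf : Continuous f) {x : ℝ}
    (hx : x ∈ Set.Icc (-1 : ℝ) 0) :
    dyadicMean f x 0 ^ 2 ≤ 2 * ∫ t in Iv, f t ^ 2 := by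
  have h₁ := sub_mul_sq_mean_sub_le hf (half_pow_succ_lt x 0) 0
  have h₂ : ∫ t in (x + (1 / 2) ^ (0 + 1))..(x + (1 / 2) ^ 0), (f t - 0) ^ 2 ≤
      ∫ t in Iv, f t ^ 2 := by
    simp only [sub_zero]
    rw [intervalIntegral.integral_of_le (half_pow_succ_lt x 0).le, integral_Ioc_eq_integral_Ioo]
    exact setIntegral_mono_set
      (((by fun_prop : Continuous _).integrableOn_Icc).mono_set Set.Ioo_subset_Icc_self)
      (Filter.Eventually.of_forall fun s => by positivity)
      (Filter.Eventually.of_forall (Ioo_dyadic_subset hx 0))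
  have h₃ := h₁.trans h₂
  change (x + (1 / 2) ^ 0 - (x + (1 / 2) ^ (0 + 1))) * (dyadicMean f x 0 - 0) ^ 2 ≤ _ at h₃
  rw [sub_zero] at h₃
  norm_num at h₃
  linarith

lemma sq_dyadicMean_le {f : ℝ → ℝ} (hf : Continuous f) {L : ℝ}
    (hL : ∀ t ∈ Iv, ∀ s ∈ Iv, |f t - f s| ≤ L * |t - s|) {x : ℝ}
    (hx : x ∈ Set.Icc (-1 : ℝ) 0) (N : ℕ) :
    dyadicMean f x N ^ 2 ≤ 8 * (N + 1) * halfNormSq f := by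
  set S := ∑ k ∈ Finset.range N, (dyadicMean f x k - dyadicMean f x (k + 1)) with hS
  have hN : dyadicMean f x N = dyadicMean f x 0 - S := by
    rw [hS, Finset.sum_range_sub']; ring
  have hS2 : S ^ 2 ≤ N * ∑ k ∈ Finset.range N,
      (dyadicMean f x k - dyadicMean f x (k + 1)) ^ 2 := by
    simpa only [Finset.card_range] using sq_sum_le_card_mul_sum_sq (s := Finset.range N)
      (f := fun k => dyadicMean f x k - dyadicMean f x (k + 1))
  have hsum := sum_sq_dyadicMean_sub_le hf hL hx N
  have h0 := sq_dyadicMean_zero_le hf hx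
  have hA : 0 ≤ ∫ t in Iv, f t ^ 2 := integral_nonneg fun _ => by positivity
  set A := ∫ t in Iv, f t ^ 2
  set B := ∫ t in Iv, gagliardoInner f t
  rw [halfNormSq_eq, hN]
  rcases N.eq_zero_or_pos with rfl | hpos
  · have hB : 0 ≤ B := integral_nonneg (gagliardoInner_nonneg f)
    have : S = 0 := by simp [hS]
    rw [this]; push_cast; nlinarith
  have hn : (1 : ℝ) ≤ N := by exact_mod_cast hpos
  have hSB : S ^ 2 ≤ N * (8 * B) := hS2.trans (by gcongr)
  have hyoung : N * (dyadicMean f x 0 - S) ^ 2 ≤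
      (N + 1) * (N * dyadicMean f x 0 ^ 2 + S ^ 2) := by
    nlinarith [sq_nonneg (N * dyadicMean f x 0 + S)]
  have : N * (dyadicMean f x 0 - S) ^ 2 ≤ N * (8 * (N + 1) * (A + B)) := by
    calc _ ≤ ((N : ℝ) + 1) * (N * (8 * A) + N * (8 * B)) := by
          refine hyoung.trans ?_
          gcongr
          linarith
      _ = _ := by ring
  exact le_of_mul_le_mul_left this (by linarith)

lemma setIntegral_Iv_comp_neg (g : ℝ → ℝ) : ∫ t in Iv, g (-t) = ∫ t in Iv, g t := by
  have h : ∀ g : ℝ → ℝ, ∫ t in Iv, g t = ∫ t in (-1 : ℝ)..1, g t := fun g => by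
    rw [intervalIntegral.integral_of_le (by norm_num), integral_Ioc_eq_integral_Ioo, Iv]
  rw [h, h, intervalIntegral.integral_comp_neg, neg_neg]

lemma halfNormSq_comp_neg (f : ℝ → ℝ) : halfNormSq (fun t => f (-t)) = halfNormSq f := by
  have h : ∀ t, gagliardoInner (fun t => f (-t)) t = gagliardoInner f (-t) := by
    intro t
    rw [gagliardoInner, gagliardoInner, ← setIntegral_Iv_comp_neg]
    congr 1 with s
    rw [neg_neg, ← abs_neg (t - -s)]
    ring_nf
  rw [halfNormSq_eq, halfNormSq_eq, setIntegral_Iv_comp_neg fun t => f t ^ 2]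
  simp_rw [h]
  rw [setIntegral_Iv_comp_neg]

open Polynomial in
lemma sq_eval_max_le {W : ℕ} {q : ℝ[X]} (hq : q.natDegree ≤ W) {x : ℝ}
    (hx : x ∈ Set.Icc (-1 : ℝ) 0)
    (hmax : ∀ y ∈ Set.Icc (-1 : ℝ) 1, |q.eval y| ≤ |q.eval x|) {N : ℕ} (hN : 4 * W ^ 2 ≤ 2 ^ N) :
    q.eval x ^ 2 ≤ 32 * (N + 1) * halfNormSq fun t => q.eval t := by
  rcases (abs_nonneg (q.eval x)).eq_or_lt with h0 | hM
  · rw [abs_eq_zero.mp h0.symm, halfNormSq_eq]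
    have h₁ : 0 ≤ ∫ t in Iv, q.eval t ^ 2 := integral_nonneg fun _ => by positivity
    have h₂ : 0 ≤ ∫ t in Iv, gagliardoInner (fun t => q.eval t) t :=
      integral_nonneg (gagliardoInner_nonneg _)
    rw [zero_pow two_ne_zero]
    exact mul_nonneg (by positivity) (add_nonneg h₁ h₂)
  set M := |q.eval x|
  have hlip : ∀ t ∈ Set.Icc (-1 : ℝ) 1, ∀ s ∈ Set.Icc (-1 : ℝ) 1,
      |q.eval t - q.eval s| ≤ 2 * W ^ 2 * M * |t - s| := by
    intro t ht s hs
    refine (convex_Icc (-1 : ℝ) 1).norm_image_sub_le_of_norm_deriv_le (f := fun t => q.eval t)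
      (fun y _ => q.differentiableAt) (fun y hy => ?_) hs ht
    rw [Polynomial.deriv]
    exact abs_eval_derivative_le hM hq hmax hy
  have hmean : |dyadicMean (fun t => q.eval t) x N - q.eval x| ≤ M / 2 := by
    refine abs_mean_sub_le q.continuous (half_pow_succ_lt x N) fun t ht => ?_
    have h₁ : (0 : ℝ) < (1 / 2) ^ (N + 1) := by positivity
    have h₂ : (1 / 2 : ℝ) ^ N ≤ 1 := pow_le_one₀ (by norm_num) (by norm_num)
    have h₃ : (4 * W ^ 2 : ℝ) * (1 / 2) ^ N ≤ 1 := by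
      rw [one_div, inv_pow, mul_inv_le_iff₀ (by positivity), one_mul]
      exact_mod_cast hN
    refine (hlip t ⟨by linarith [ht.1, hx.1], by linarith [ht.2, hx.2]⟩ x
      ⟨hx.1, by linarith [hx.2]⟩).trans ?_
    rw [abs_of_nonneg (by linarith [ht.1])]
    calc 2 * (W : ℝ) ^ 2 * M * (t - x) ≤ 2 * (W : ℝ) ^ 2 * M * (1 / 2) ^ N := by
          gcongr; linarith [ht.2]
      _ = M / 2 * (4 * W ^ 2 * (1 / 2) ^ N) := by ring
      _ ≤ M / 2 := mul_le_of_le_one_right (by positivity) h₃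
  have hD := sq_dyadicMean_le q.continuous
    (fun t ht s hs => hlip t (Set.Ioo_subset_Icc_self ht) s (Set.Ioo_subset_Icc_self hs)) hx N
  set D := dyadicMean (fun t => q.eval t) x N
  have hMD : M / 2 ≤ |D| := by
    have := abs_sub_abs_le_abs_sub (q.eval x) D
    rw [abs_sub_comm] at this
    change M - |D| ≤ _ at this
    linarith
  have : (M / 2) ^ 2 ≤ |D| ^ 2 := by gcongr
  rw [sq_abs, div_pow, sq_abs] at this
  linarith

/-- Polynomial `L∞`–`H^{1/2}` inverse inequality with logarithmic factor: there exists
`C > 0` such that for every integer `W ≥ 2` and every real polynomial `q` of degree at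
most `W` on `(−1,1)`, `‖q‖²_{L∞([−1,1])} ≤ C (ln W) ‖q‖²_{1/2,I}`. -/
theorem polynomial_Linfty_Hhalf_inverse_inequality :
    ∃ C : ℝ, 0 < C ∧ ∀ W : ℕ, 2 ≤ W → ∀ q : Polynomial ℝ, q.natDegree ≤ W →
      (⨆ x : Set.Icc (-1 : ℝ) 1, (q.eval (x : ℝ)) ^ 2)
        ≤ C * Real.log W * halfNormSq (fun t => q.eval t) := by
  refine ⟨224 / Real.log 2, div_pos (by norm_num) (Real.log_pos (by norm_num)), ?_⟩
  intro W hW q hq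
  obtain ⟨x, hx, hmax⟩ := isCompact_Icc.exists_isMaxOn (Set.nonempty_Icc.mpr (by norm_num))
    (q.continuous.abs.continuousOn (s := Set.Icc (-1 : ℝ) 1))
  replace hmax : ∀ y ∈ Set.Icc (-1 : ℝ) 1, |q.eval y| ≤ |q.eval x| := fun y hy => hmax hy
  have : Nonempty (Set.Icc (-1 : ℝ) 1) := ⟨x, hx⟩
  refine ciSup_le fun y => (sq_le_sq.mpr (hmax y y.2)).trans ?_
  set l := Nat.log 2 W
  have hN : 4 * W ^ 2 ≤ 2 ^ (2 * l + 4) := by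
    have h : W < 2 ^ (l + 1) := Nat.lt_pow_succ_log_self (by norm_num) W
    calc 4 * W ^ 2 ≤ 4 * (2 ^ (l + 1)) ^ 2 := by gcongr
      _ = 2 ^ (2 * l + 4) := by ring
  have hH : q.eval x ^ 2 ≤
      32 * ((2 * l + 4 : ℕ) + 1) * halfNormSq fun t => q.eval t := by
    rcases le_total x 0 with h0 | h0
    · exact sq_eval_max_le hq ⟨hx.1, h0⟩ hmax hN
    · have h := sq_eval_max_le (q := q.comp (-Polynomial.X)) (x := -x)
        (by simpa [Polynomial.natDegree_comp] using hq)
        ⟨by linarith [hx.2], by linarith⟩ (by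
          intro y hy
          simpa using hmax (-y) ⟨by linarith [hy.2], by linarith [hy.1]⟩) hN
      simpa [halfNormSq_comp_neg fun t => q.eval t] using h
  have hnonneg : 0 ≤ halfNormSq fun t => q.eval t := by
    have : (0 : ℝ) < 32 * ((2 * l + 4 : ℕ) + 1) := by positivity
    exact nonneg_of_mul_nonneg_right ((sq_nonneg _).trans hH) this
  refine hH.trans (mul_le_mul_of_nonneg_right ?_ hnonneg)
  have hlog2 : 0 < Real.log 2 := Real.log_pos (by norm_num)
  have h₁ : Real.log 2 ≤ Real.log W :=
    Real.log_le_log (by norm_num) (by exact_mod_cast hW)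
  have h₂ : l * Real.log 2 ≤ Real.log W := by
    rw [← Real.log_pow]
    exact Real.log_le_log (by positivity)
      (by exact_mod_cast Nat.pow_log_le_self 2 (by omega))
  rw [div_mul_eq_mul_div, le_div_iff₀ hlog2]
  push_cast
  nlinarith
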